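/- For all n ∈ ℕ and t > 0, the n-th moment of μ_{sc,2√t} ⊞ Unif_{[-t,0]} equals n! * ∑_{j=⌈n/2⌉}^{n} t^j/(j!(1+j)!) * s(1+j, n+1-j), where s denotes signed Stirling numbers of the first kind. -/

import Mathlib

open MeasureTheory

/-- Signed Stirling numbers of the first kind. -/
def stirlingS1 : ℕ → ℕ → ℤ
  | 0, 0 => 1
  | 0, _ + 1 => 0
  | _ + 1, 0 => 0
  | n + 1, k + 1 => stirlingS1 n k - n * stirlingS1 n (k + 1)

/-- The `n`-th moment of a measure on `ℝ`. -/
noncomputable def moment (μ : Measure ℝ) (n : ℕ) : ℝ := ∫ x, x ^ n ∂μ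

/-- The free cumulants of a measure on `ℝ`, defined recursively through the
moment–cumulant relation `mₙ = ∑_{s=1}^n κ_s ∑_{i₁+⋯+i_s = n-s} m_{i₁} ⋯ m_{i_s}`,
which for measures with all moments finite is equivalent to the usual definition via
sums over non-crossing partitions. -/
noncomputable def freeCumulant (μ : Measure ℝ) : ℕ → ℝ
  | 0 => 0
  | n + 1 =>
    moment μ (n + 1) -
      ∑ s ∈ (Finset.range n).attach,
        freeCumulant μ (s.1 + 1) *
          ∑ p ∈ Finset.Nat.antidiagonalTuple (s.1 + 1) (n - s.1),
            ∏ j, moment μ (p j)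
  decreasing_by
    have := s.2
    simp only [Finset.mem_range] at this
    omega

/-- `IsFreeAdd μ ν ρ` asserts that `ρ` is the free additive convolution `μ ⊞ ν`,
characterized by additivity of free cumulants. -/
def IsFreeAdd (μ ν ρ : Measure ℝ) : Prop :=
  ∀ n : ℕ, freeCumulant ρ n = freeCumulant μ n + freeCumulant ν n

/-- The semicircle distribution of radius `R`. -/
noncomputable def semicircle (R : ℝ) : Measure ℝ :=
  (volume.restrict (Set.Icc (-R) R)).withDensity fun x =>
    ENNReal.ofReal (2 / (Real.pi * R ^ 2) * Real.sqrt (R ^ 2 - x ^ 2))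

/-- The uniform distribution on `[a, b]`. -/
noncomputable def unif (a b : ℝ) : Measure ℝ :=
  (ENNReal.ofReal (b - a))⁻¹ • volume.restrict (Set.Icc a b)

section PowerSeriesLemmas
open PowerSeries Finset

theorem coeff_pow_eq_sum_antidiagonalTuple {R : Type*} [CommSemiring R] (F : R⟦X⟧) (k n : ℕ) :
    coeff n (F ^ k) = ∑ p ∈ Finset.Nat.antidiagonalTuple k n, ∏ j, coeff (p j) F := by
  have h := PowerSeries.coeff_prod (fun _ : Fin k => F) n Finset.univ
  rw [Finset.prod_const, Finset.card_univ, Fintype.card_fin] at h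
  rw [h]
  refine Finset.sum_nbij' (fun l => ⇑l) (fun p => Finsupp.equivFunOnFinite.symm p) ?_ ?_ ?_ ?_ ?_
  · intro l hl
    simpa [Finset.Nat.mem_antidiagonalTuple, Finset.mem_finsuppAntidiag] using hl
  · intro p hp
    simpa [Finset.Nat.mem_antidiagonalTuple, Finset.mem_finsuppAntidiag] using hp
  · intro l _
    ext; simp
  · intro p _
    rfl
  · intro l _
    rfl

section Lagrange
variable {K : Type*} [Field K]

theorem coeff_pow_succ_of_functional_eq {F G : K⟦X⟧}
    (h : ∀ n, coeff n F = ∑ s ∈ range (n + 1), coeff s G * coeff (n - s) (F ^ s)) (n k : ℕ) :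
    coeff n (F ^ (k + 1)) = ∑ s ∈ range (n + 1), coeff s G * coeff (n - s) (F ^ (k + s)) := by
  have key : ∀ m ≤ n,
      coeff m F = coeff m (∑ s ∈ range (n + 1), C (coeff s G) * (X ^ s * F ^ s)) := by
    intro m hm
    rw [h, map_sum]
    simp only [coeff_C_mul, coeff_X_pow_mul']
    rw [← Finset.sum_subset (Finset.range_mono (Nat.succ_le_succ hm))]
    · refine Finset.sum_congr rfl fun s hs => ?_
      rw [if_pos (by simpa [Nat.lt_succ_iff] using hs)]
    · intro s _ hs
      rw [if_neg (by simpa using hs), mul_zero]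
  have : coeff n (F ^ (k + 1)) =
      coeff n (F ^ k * ∑ s ∈ range (n + 1), C (coeff s G) * (X ^ s * F ^ s)) := by
    rw [pow_succ, coeff_mul, coeff_mul]
    refine Finset.sum_congr rfl fun p hp => ?_
    rw [key p.2 (by have := mem_antidiagonal.1 hp; omega)]
  rw [this, Finset.mul_sum, map_sum]
  refine Finset.sum_congr rfl fun s hs => ?_
  rw [show F ^ k * (C (coeff s G) * (X ^ s * F ^ s)) = C (coeff s G) * (X ^ s * F ^ (k + s)) by ring,
    coeff_C_mul, coeff_X_pow_mul', if_pos (by simpa [Nat.lt_succ_iff] using hs)]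

theorem coeff_X_mul_derivative (F : K⟦X⟧) (n : ℕ) :
    coeff n (X * derivative K F) = n * coeff n F := by
  cases n with
  | zero => simp
  | succ n => rw [coeff_succ_X_mul, coeff_derivative]; push_cast; ring

variable [CharZero K]

/-- Lagrange inversion: the powers of the solution `F` of `F = G(X F)`. -/
theorem lagrange_inversion {F G : K⟦X⟧}
    (h : ∀ n, coeff n F = ∑ s ∈ range (n + 1), coeff s G * coeff (n - s) (F ^ s)) (n k : ℕ) :
    ((n + k : ℕ) : K) * coeff n (F ^ k) = k * coeff n (G ^ (n + k)) := by
  induction n using Nat.strong_induction_on generalizing k with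
  | _ n ihn =>
  induction k with
  | zero =>
    rcases Nat.eq_zero_or_pos n with rfl | hn
    · simp
    · simp [coeff_one, hn.ne']
  | succ k ihk =>
    rcases Nat.eq_zero_or_pos (n + k) with hN | hN
    · obtain ⟨rfl, rfl⟩ : n = 0 ∧ k = 0 := by omega
      have := h 0
      simp at this
      simp [this]
    have hN' : ((n + k : ℕ) : K) ≠ 0 := by exact_mod_cast hN.ne'
    have h1 : ((n + k : ℕ) : K) * coeff n (F ^ (k + 1)) =
        coeff n ((C (k : K) * G + X * derivative K G) * G ^ (n + k)) := by
      rw [coeff_pow_succ_of_functional_eq h, Finset.mul_sum, coeff_mul,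
        Finset.Nat.sum_antidiagonal_eq_sum_range_succ_mk]
      refine Finset.sum_congr rfl fun s hs => ?_
      have hs' : s ≤ n := by simpa [Nat.lt_succ_iff] using hs
      have h2 : ((n + k : ℕ) : K) * coeff (n - s) (F ^ (k + s)) =
          ((k + s : ℕ) : K) * coeff (n - s) (G ^ (n + k)) := by
        rcases Nat.eq_zero_or_pos s with rfl | hs0
        · simpa using ihk
        · have := ihn (n - s) (by omega) (k + s)
          rwa [show n - s + (k + s) = n + k by omega] at this
      rw [map_add, coeff_C_mul, coeff_X_mul_derivative, mul_left_comm, h2]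
      push_cast; ring
    have h3 : (C ((n + k + 1 : ℕ) : K)) * ((C (k : K) * G + X * derivative K G) * G ^ (n + k)) =
        C ((k * (n + k + 1) : ℕ) : K) * G ^ (n + k + 1) + X * derivative K (G ^ (n + k + 1)) := by
      rw [derivative_pow]
      simp only [map_natCast, Nat.add_sub_cancel]
      push_cast; ring
    have h4 := congrArg (coeff n) h3
    rw [coeff_C_mul, ← h1, map_add, coeff_C_mul, coeff_X_mul_derivative] at h4
    refine mul_left_cancel₀ hN' ?_
    rw [show n + (k + 1) = n + k + 1 by ring]
    push_cast at h4 ⊢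
    linear_combination h4

/-- A series `G` with constant coefficient `1` is determined by the coefficients of `G ^ (n + 1)`
in degree `n`. -/
theorem eq_of_coeff_pow_succ_eq {G H : K⟦X⟧} (hG : constantCoeff G = 1) (hH : constantCoeff H = 1)
    (h : ∀ n, coeff n (G ^ (n + 1)) = coeff n (H ^ (n + 1))) : G = H := by
  ext n
  induction n using Nat.strong_induction_on with
  | _ n ih =>
  obtain ⟨E, hE⟩ : X ^ n ∣ G - H := by
    rw [X_pow_dvd_iff]
    intro m hm
    rw [map_sub, ih m hm, sub_self]
  have h1 : coeff n (G ^ (n + 1) - H ^ (n + 1)) = (n + 1) * constantCoeff E := by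
    rw [← Commute.mul_geom_sum₂ (Commute.all G H), hE, mul_assoc, coeff_X_pow_mul',
      if_pos le_rfl, Nat.sub_self, coeff_zero_eq_constantCoeff_apply, map_mul, map_sum]
    simp [hG, hH, mul_comm]
  rw [map_sub, h, sub_self] at h1
  have h2 : constantCoeff E = 0 := by
    have : (n + 1 : K) ≠ 0 := by exact_mod_cast n.succ_ne_zero
    simpa [this] using h1.symm
  have h3 : coeff n (G - H) = 0 := by
    rw [hE, coeff_X_pow_mul', if_pos le_rfl, Nat.sub_self, coeff_zero_eq_constantCoeff_apply, h2]
  rwa [map_sub, sub_eq_zero] at h3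

end Lagrange

theorem X_mul_derivative_bernoulliPowerSeries :
    X * derivative ℝ (bernoulliPowerSeries ℝ) =
      bernoulliPowerSeries ℝ - X * bernoulliPowerSeries ℝ - bernoulliPowerSeries ℝ ^ 2 := by
  have h := bernoulliPowerSeries_mul_exp_sub_one ℝ
  have h' := congrArg (derivative ℝ) h
  rw [Derivation.leibniz, map_sub, derivative_exp, derivative_one, derivative_X] at h'
  simp only [smul_eq_mul, sub_zero] at h'
  linear_combination (bernoulliPowerSeries ℝ) * h' -
    (derivative ℝ (bernoulliPowerSeries ℝ) + bernoulliPowerSeries ℝ) * h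

theorem bernoulliPowerSeries_pow_succ (k : ℕ) :
    C ((k : ℝ) + 1) * bernoulliPowerSeries ℝ ^ (k + 2) =
      C ((k : ℝ) + 1) * (bernoulliPowerSeries ℝ ^ (k + 1) - X * bernoulliPowerSeries ℝ ^ (k + 1)) -
        X * derivative ℝ (bernoulliPowerSeries ℝ ^ (k + 1)) := by
  rw [derivative_pow, Nat.add_sub_cancel]
  have h := X_mul_derivative_bernoulliPowerSeries
  simp only [map_add, map_natCast, map_one]
  push_cast
  linear_combination ((k + 1) * bernoulliPowerSeries ℝ ^ k) * h

end PowerSeriesLemmas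

theorem stirlingS1_eq_zero_of_lt {n k : ℕ} (h : n < k) : stirlingS1 n k = 0 := by
  induction n generalizing k with
  | zero =>
    cases k with
    | zero => omega
    | succ k => rfl
  | succ n ih =>
    cases k with
    | zero => omega
    | succ k => rw [stirlingS1, ih (by omega), ih (by omega)]; simp

theorem stirlingS1_succ_one (n : ℕ) : stirlingS1 (n + 1) 1 = (-1) ^ n * n.factorial := by
  induction n with
  | zero => rfl
  | succ n ih =>
    rw [stirlingS1, ih, stirlingS1, Nat.factorial_succ]
    push_cast
    ring

open PowerSeries Finset in
theorem coeff_bernoulliPowerSeries_pow (k m : ℕ) (hm : m ≤ k) :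
    (k.factorial : ℝ) * coeff m (bernoulliPowerSeries ℝ ^ (k + 1)) =
      (stirlingS1 (k + 1) (k + 1 - m) : ℝ) * ((k - m).factorial : ℝ) := by
  induction k generalizing m with
  | zero =>
    obtain rfl : m = 0 := by omega
    simp [bernoulliPowerSeries, stirlingS1]
  | succ k ih =>
    have h := congrArg (coeff m) (bernoulliPowerSeries_pow_succ k)
    rw [map_sub, coeff_C_mul, coeff_C_mul, coeff_X_mul_derivative, map_sub] at h
    have hS : stirlingS1 (k + 1 + 1) (k + 1 + 1 - m) =
        stirlingS1 (k + 1) (k + 1 - m) - (k + 1) * stirlingS1 (k + 1) (k + 2 - m) := by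
      rw [show k + 1 + 1 - m = (k + 1 - m) + 1 by omega, stirlingS1,
        show k + 1 - m + 1 = k + 2 - m by omega]
      push_cast; ring
    rw [hS]
    have hA : ((k + 1 : ℝ) - m) * k.factorial * coeff m (bernoulliPowerSeries ℝ ^ (k + 1)) =
        (stirlingS1 (k + 1) (k + 1 - m) : ℝ) * ((k + 1 - m).factorial : ℝ) := by
      rcases Nat.lt_or_ge k m with hkm | hkm
      · obtain rfl : m = k + 1 := by omega
        simp [stirlingS1]
      · have := ih m hkm
        rw [show k + 1 - m = (k - m) + 1 by omega, Nat.factorial_succ]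
        rw [show k + 1 - m = (k - m) + 1 by omega] at this
        push_cast [Nat.cast_sub hkm]
        linear_combination ((k + 1 : ℝ) - m) * this
    have hB : (k.factorial : ℝ) * coeff m (X * bernoulliPowerSeries ℝ ^ (k + 1)) =
        (stirlingS1 (k + 1) (k + 2 - m) : ℝ) * ((k + 1 - m).factorial : ℝ) := by
      cases m with
      | zero => simp [stirlingS1_eq_zero_of_lt (show k + 1 < k + 2 by omega)]
      | succ m =>
        rw [coeff_succ_X_mul, ih m (by omega), show k + 2 - (m + 1) = k + 1 - m by omega,
          Nat.add_sub_add_right]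
    rw [Nat.factorial_succ]
    push_cast
    linear_combination (k.factorial : ℝ) * h + hA - (k + 1) * hB

open PowerSeries Finset in
theorem coeff_add_C_mul_X_sq_pow (F : ℝ⟦X⟧) (t : ℝ) (n : ℕ) :
    coeff n ((F + C t * X ^ 2) ^ (n + 1)) =
      ∑ j ∈ Icc ((n + 1) / 2) n,
        ((n + 1).choose (j + 1) : ℝ) * t ^ (n - j) * coeff (2 * j - n) (F ^ (j + 1)) := by
  rw [add_pow, map_sum, Finset.sum_range_succ']
  have hterm (k d m : ℕ) : coeff n (F ^ k * (C t * X ^ 2) ^ d * (m : ℝ⟦X⟧)) =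
      if 2 * d ≤ n then (m : ℝ) * t ^ d * coeff (n - 2 * d) (F ^ k) else 0 := by
    rw [show F ^ k * (C t * X ^ 2) ^ d * (m : ℝ⟦X⟧) =
      C ((m : ℝ) * t ^ d) * (X ^ (2 * d) * F ^ k) by
        rw [map_mul, map_pow, map_natCast]; ring, coeff_C_mul, coeff_X_pow_mul']
    split_ifs <;> simp
  simp only [hterm]
  rw [if_neg (by omega), add_zero, ← Finset.sum_filter]
  refine Finset.sum_congr ?_ fun j hj => ?_
  · ext j; simp only [mem_filter, mem_range, mem_Icc]; omega
  · have := mem_Icc.1 hj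
    rw [show n + 1 - (j + 1) = n - j by omega, show n - 2 * (n - j) = 2 * j - n by omega]

theorem moment_semicircle_eq {R : ℝ} (hR : 0 < R) (n : ℕ) :
    moment (semicircle R) n =
      2 / (Real.pi * R ^ 2) * ∫ x in (-R)..R, x ^ n * √(R ^ 2 - x ^ 2) := by
  rw [moment, semicircle, integral_withDensity_eq_integral_toReal_smul₀ (by fun_prop) (by simp),
    intervalIntegral.integral_of_le (by linarith), integral_Icc_eq_integral_Ioc,
    ← integral_const_mul]
  refine integral_congr_ae (Filter.Eventually.of_forall fun x => ?_)
  simp only [smul_eq_mul]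
  rw [ENNReal.toReal_ofReal (by positivity)]
  ring

theorem hasDerivAt_mul_sqrt_sq_sub_sq {R x : ℝ} (hx : x ∈ Set.Ioo (-R) R) :
    HasDerivAt (fun x => (R ^ 2 - x ^ 2) * √(R ^ 2 - x ^ 2)) (-3 * x * √(R ^ 2 - x ^ 2)) x := by
  have hpos : 0 < R ^ 2 - x ^ 2 := by nlinarith [hx.1, hx.2]
  have h1 : HasDerivAt (fun x : ℝ => R ^ 2 - x ^ 2) (-(2 * x)) x := by
    simpa using ((hasDerivAt_id x).pow 2).const_sub (R ^ 2)
  refine (h1.mul (h1.sqrt hpos.ne')).congr_deriv ?_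
  have hs := Real.mul_self_sqrt hpos.le
  have hs' : √(R ^ 2 - x ^ 2) ≠ 0 := (Real.sqrt_pos.2 hpos).ne'
  field_simp
  linear_combination x * hs

theorem integral_pow_mul_sqrt_sq_sub_sq_one {R : ℝ} (hR : 0 < R) :
    ∫ x in (-R)..R, x ^ 1 * √(R ^ 2 - x ^ 2) = 0 := by
  have h := intervalIntegral.integral_eq_sub_of_hasDerivAt_of_le
    (f := fun x => (R ^ 2 - x ^ 2) * √(R ^ 2 - x ^ 2)) (by linarith : -R ≤ R) (by fun_prop)
    (fun x hx => hasDerivAt_mul_sqrt_sq_sub_sq hx)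
    (Continuous.intervalIntegrable (by fun_prop) _ _)
  simp only [mul_assoc, intervalIntegral.integral_const_mul] at h
  simp only [pow_one]
  simpa using h

theorem integral_pow_add_two_mul_sqrt_sq_sub_sq {R : ℝ} (hR : 0 < R) (n : ℕ) :
    (n + 4) * ∫ x in (-R)..R, x ^ (n + 2) * √(R ^ 2 - x ^ 2) =
      (n + 1) * R ^ 2 * ∫ x in (-R)..R, x ^ n * √(R ^ 2 - x ^ 2) := by
  have h := intervalIntegral.integral_eq_sub_of_hasDerivAt_of_le
    (f := fun x => x ^ (n + 1) * ((R ^ 2 - x ^ 2) * √(R ^ 2 - x ^ 2)))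
    (f' := fun x => (n + 1) * R ^ 2 * (x ^ n * √(R ^ 2 - x ^ 2)) -
      (n + 4) * (x ^ (n + 2) * √(R ^ 2 - x ^ 2))) (by linarith : -R ≤ R) (by fun_prop)
    (fun x hx => by
      refine ((hasDerivAt_pow (n + 1) x).mul (hasDerivAt_mul_sqrt_sq_sub_sq hx)).congr_deriv ?_
      push_cast [Nat.add_sub_cancel]
      ring)
    (Continuous.intervalIntegrable (by fun_prop) _ _)
  rw [intervalIntegral.integral_sub (Continuous.intervalIntegrable (by fun_prop) _ _)
    (Continuous.intervalIntegrable (by fun_prop) _ _), intervalIntegral.integral_const_mul,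
    intervalIntegral.integral_const_mul] at h
  simp at h
  linarith

theorem integral_pow_mul_sqrt_sq_sub_sq_zero {R : ℝ} (hR : 0 < R) :
    ∫ x in (-R)..R, x ^ 0 * √(R ^ 2 - x ^ 2) = Real.pi * R ^ 2 / 2 := by
  have h := intervalIntegral.mul_integral_comp_mul_left (a := -1) (b := 1)
    (f := fun x => √(R ^ 2 - x ^ 2)) (c := R)
  have h2 : ∀ x : ℝ, √(R ^ 2 - (R * x) ^ 2) = R * √(1 - x ^ 2) := fun x => by
    rw [show R ^ 2 - (R * x) ^ 2 = R ^ 2 * (1 - x ^ 2) by ring, Real.sqrt_mul (sq_nonneg R),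
      Real.sqrt_sq hR.le]
  simp only [h2, intervalIntegral.integral_const_mul, integral_sqrt_one_sub_sq, mul_neg,
    mul_one] at h
  simp only [pow_zero, one_mul]
  rw [← h]; ring

theorem moment_unif {t : ℝ} (ht : 0 < t) (n : ℕ) :
    moment (unif (-t) 0) n = (-t) ^ n / (n + 1) := by
  rw [moment, unif, integral_smul_measure, integral_Icc_eq_integral_Ioc,
    ← intervalIntegral.integral_of_le (by linarith), integral_pow]
  have : (0 - -t) = t := by ring
  rw [this, ENNReal.toReal_inv, ENNReal.toReal_ofReal ht.le, smul_eq_mul]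
  have : (n + 1 : ℝ) ≠ 0 := by positivity
  field_simp
  simp
  ring

open PowerSeries Finset in
theorem coeff_one_add_C_mul_X_sq_pow_add_two (t : ℝ) (n : ℕ) :
    (n + 4) * (coeff (n + 2) ((1 + C t * X ^ 2) ^ (n + 3)) / (n + 3)) =
      4 * t * (n + 1) * (coeff n ((1 + C t * X ^ 2) ^ (n + 1)) / (n + 1)) := by
  have hodd (k : ℕ) : coeff (2 * k + 1) ((1 + C t * X ^ 2) ^ (2 * k + 1 + 1)) = 0 := by
    rw [coeff_add_C_mul_X_sq_pow]
    refine Finset.sum_eq_zero fun j hj => ?_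
    have := mem_Icc.1 hj
    rw [one_pow, coeff_one, if_neg (by omega), mul_zero]
  have heven (k : ℕ) : (k + 1 : ℝ) * coeff (2 * k) ((1 + C t * X ^ 2) ^ (2 * k + 1)) =
      (2 * k + 1) * t ^ k * k.centralBinom := by
    rw [coeff_add_C_mul_X_sq_pow, Finset.sum_eq_single k]
    · have := Nat.add_one_mul_choose_eq (2 * k) k
      rw [← Nat.centralBinom] at this
      have : ((2 * k + 1 : ℝ)) * k.centralBinom = (2 * k + 1).choose (k + 1) * (k + 1) := by
        exact_mod_cast this
      rw [one_pow, show 2 * k - k = k by omega, Nat.sub_self, coeff_zero_one]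
      linear_combination (- t ^ k) * this
    · intro j hj hjk
      have := mem_Icc.1 hj
      rw [one_pow, coeff_one, if_neg (by omega), mul_zero]
    · intro h
      exact absurd (mem_Icc.2 ⟨by omega, by omega⟩) h
  rcases Nat.even_or_odd' n with ⟨k, rfl | rfl⟩
  · have h1 := heven k
    have h2 := heven (k + 1)
    have h3 : ((k : ℝ) + 1) * (k + 1).centralBinom = 2 * (2 * k + 1) * k.centralBinom := by
      exact_mod_cast Nat.succ_mul_centralBinom_succ k
    rw [show 2 * (k + 1) = 2 * k + 2 by ring] at h2
    push_cast at h1 h2 ⊢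
    have a1 : (k + 1 : ℝ) ≠ 0 := by positivity
    have a2 : (2 * k + 1 : ℝ) ≠ 0 := by positivity
    have a3 : (2 * k + 3 : ℝ) ≠ 0 := by positivity
    field_simp
    refine mul_left_cancel₀ a1 ?_
    linear_combination 2 * (k + 1) * h2 - 4 * t * (2 * k + 3) * h1
      + 2 * (2 * k + 3) * t ^ (k + 1) * h3
  · have h2 := hodd (k + 1)
    rw [show 2 * (k + 1) + 1 = 2 * k + 1 + 2 by ring] at h2
    rw [hodd k, show 2 * k + 1 + 3 = 2 * k + 1 + 2 + 1 by ring, h2]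
    simp

open PowerSeries in
theorem moment_semicircle {t : ℝ} (ht : 0 < t) (n : ℕ) :
    moment (semicircle (2 * √t)) n = coeff n ((1 + C t * X ^ 2) ^ (n + 1)) / (n + 1) := by
  have hR : 0 < 2 * √t := by positivity
  have hR2 : (2 * √t) ^ 2 = 4 * t := by rw [mul_pow, Real.sq_sqrt ht.le]; norm_num
  induction n using Nat.twoStepInduction with
  | zero =>
    rw [moment_semicircle_eq hR, integral_pow_mul_sqrt_sq_sub_sq_zero hR]
    have := Real.pi_ne_zero
    have := hR.ne'
    simp only [zero_add, pow_one, Nat.cast_zero, div_one, coeff_zero_eq_constantCoeff]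
    field_simp
    simp
  | one =>
    rw [moment_semicircle_eq hR, integral_pow_mul_sqrt_sq_sub_sq_one hR, mul_zero,
      coeff_add_C_mul_X_sq_pow]
    simp [coeff_one]
  | more n ih _ =>
    have h := integral_pow_add_two_mul_sqrt_sq_sub_sq hR n
    have h' := coeff_one_add_C_mul_X_sq_pow_add_two t n
    rw [← ih, moment_semicircle_eq hR] at h'
    rw [moment_semicircle_eq hR]
    have hn : (n + 4 : ℝ) ≠ 0 := by positivity
    refine mul_left_cancel₀ hn ?_
    push_cast
    rw [show ((n : ℝ) + 2 + 1) = n + 3 by ring, h']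
    set c := 2 / (Real.pi * (2 * √t) ^ 2)
    linear_combination c * h + (n + 1) * (c * ∫ x in (-(2 * √t))..(2 * √t),
      x ^ n * √((2 * √t) ^ 2 - x ^ 2)) * hR2

open PowerSeries in
/-- The generating series `1 + ∑ κₙ Xⁿ` of the free cumulants of `μ`. -/
noncomputable def cumulantSeries (μ : Measure ℝ) : ℝ⟦X⟧ := 1 + PowerSeries.mk (freeCumulant μ)

theorem constantCoeff_cumulantSeries (μ : Measure ℝ) :
    PowerSeries.constantCoeff (cumulantSeries μ) = 1 := by
  rw [cumulantSeries, map_add, ← PowerSeries.coeff_zero_eq_constantCoeff_apply (PowerSeries.mk _),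
    PowerSeries.coeff_mk, freeCumulant]
  simp

open PowerSeries Finset in
theorem moment_eq_coeff_cumulantSeries_pow {μ : Measure ℝ} (h0 : moment μ 0 = 1) (n : ℕ) :
    moment μ n = coeff n (cumulantSeries μ ^ (n + 1)) / (n + 1) := by
  have hc (s : ℕ) : coeff (s + 1) (cumulantSeries μ) = freeCumulant μ (s + 1) := by
    simp [cumulantSeries, coeff_one]
  have key : ∀ n, coeff n (PowerSeries.mk (moment μ)) = ∑ s ∈ range (n + 1),
      coeff s (cumulantSeries μ) * coeff (n - s) (PowerSeries.mk (moment μ) ^ s) := by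
    intro n
    cases n with
    | zero => simp [h0, constantCoeff_cumulantSeries]
    | succ n =>
      rw [Finset.sum_range_succ', Finset.sum_range_succ]
      simp only [hc, coeff_pow_eq_sum_antidiagonalTuple, coeff_mk, Nat.add_sub_add_right]
      rw [freeCumulant, Finset.sum_attach (range n) (fun s => freeCumulant μ (s + 1) *
        ∑ p ∈ Finset.Nat.antidiagonalTuple (s + 1) (n - s), ∏ j, moment μ (p j))]
      simp [h0, Finset.Nat.antidiagonalTuple_zero_right]
  have := lagrange_inversion key n 1
  rw [pow_one, coeff_mk] at this
  have hn : (n + 1 : ℝ) ≠ 0 := by positivity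
  rw [eq_div_iff hn]
  push_cast at this
  linear_combination this

open PowerSeries in
theorem cumulantSeries_eq_of_moment_eq {μ : Measure ℝ} {G : ℝ⟦X⟧} (hG : constantCoeff G = 1)
    (h : ∀ n, moment μ n = coeff n (G ^ (n + 1)) / (n + 1)) : cumulantSeries μ = G := by
  refine eq_of_coeff_pow_succ_eq (constantCoeff_cumulantSeries μ) hG fun n => ?_
  have hn : (n + 1 : ℝ) ≠ 0 := by positivity
  have h0 : moment μ 0 = 1 := by simp [h, hG]
  have := h n
  rw [moment_eq_coeff_cumulantSeries_pow h0] at this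
  exact (div_left_inj' hn).1 this

open PowerSeries in
theorem cumulantSeries_semicircle {t : ℝ} (ht : 0 < t) :
    cumulantSeries (semicircle (2 * √t)) = 1 + C t * X ^ 2 :=
  cumulantSeries_eq_of_moment_eq (by simp) (moment_semicircle ht)

open PowerSeries in
theorem cumulantSeries_unif {t : ℝ} (ht : 0 < t) :
    cumulantSeries (unif (-t) 0) = rescale t (bernoulliPowerSeries ℝ) := by
  refine cumulantSeries_eq_of_moment_eq ?_ fun n => ?_
  · rw [← coeff_zero_eq_constantCoeff_apply, coeff_rescale]
    simp [bernoulliPowerSeries]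
  · have h := coeff_bernoulliPowerSeries_pow n n le_rfl
    rw [Nat.add_sub_cancel_left, stirlingS1_succ_one] at h
    have hn : (n.factorial : ℝ) ≠ 0 := by positivity
    have h' : coeff n (bernoulliPowerSeries ℝ ^ (n + 1)) = (-1) ^ n := by
      refine mul_left_cancel₀ hn ?_
      rw [h]; push_cast; simp; ring
    rw [moment_unif ht, ← map_pow, coeff_rescale, h', neg_pow]
    ring

theorem IsFreeAdd.cumulantSeries_eq {μ ν ρ : Measure ℝ} (h : IsFreeAdd μ ν ρ) :
    cumulantSeries ρ = cumulantSeries μ + cumulantSeries ν - 1 := by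
  have : PowerSeries.mk (freeCumulant ρ) =
      PowerSeries.mk (freeCumulant μ) + PowerSeries.mk (freeCumulant ν) := by
    ext n
    simpa using h n
  rw [cumulantSeries, cumulantSeries, cumulantSeries, this]
  ring

theorem moment_semicircle_free_conv_unif (t : ℝ) (ht : 0 < t) (ρ : Measure ℝ)
    [IsProbabilityMeasure ρ]
    (hρ : IsFreeAdd (semicircle (2 * Real.sqrt t)) (unif (-t) 0) ρ) (n : ℕ) :
    moment ρ n =
      (n.factorial : ℝ) * ∑ j ∈ Finset.Icc ((n + 1) / 2) n,
        t ^ j / ((j.factorial : ℝ) * ((1 + j).factorial : ℝ)) *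
          (stirlingS1 (1 + j) (n + 1 - j) : ℝ) := by
  have hC : cumulantSeries ρ =
      PowerSeries.rescale t (bernoulliPowerSeries ℝ) + PowerSeries.C t * PowerSeries.X ^ 2 := by
    rw [hρ.cumulantSeries_eq, cumulantSeries_semicircle ht, cumulantSeries_unif ht]
    ring
  rw [moment_eq_coeff_cumulantSeries_pow (by simp [moment]), hC, coeff_add_C_mul_X_sq_pow,
    Finset.mul_sum, Finset.sum_div]
  refine Finset.sum_congr rfl fun j hj => ?_
  have hj := Finset.mem_Icc.1 hj
  have hB := coeff_bernoulliPowerSeries_pow j (2 * j - n) (by omega)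
  rw [show j + 1 - (2 * j - n) = n + 1 - j by omega, show j - (2 * j - n) = n - j by omega] at hB
  have hch : ((n + 1).choose (j + 1) : ℝ) * (j + 1).factorial * (n - j).factorial =
      (n + 1) * n.factorial := by
    have := Nat.choose_mul_factorial_mul_factorial (show j + 1 ≤ n + 1 by omega)
    rw [Nat.add_sub_add_right, Nat.factorial_succ n] at this
    exact_mod_cast this
  have hpow : t ^ (n - j) * t ^ (2 * j - n) = t ^ j := by
    rw [← pow_add]; congr 1; omega
  rw [← map_pow, PowerSeries.coeff_rescale, add_comm 1 j, ← hpow]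
  have h1 : (j.factorial : ℝ) ≠ 0 := by positivity
  have h2 : ((j + 1).factorial : ℝ) ≠ 0 := by positivity
  have h3 : ((n - j).factorial : ℝ) ≠ 0 := by positivity
  have hn : (n + 1 : ℝ) ≠ 0 := by positivity
  field_simp
  refine mul_left_cancel₀ h3 ?_
  generalize PowerSeries.coeff (2 * j - n) (bernoulliPowerSeries ℝ ^ (j + 1)) = b at *
  linear_combination (j.factorial * b) * hch + (n + 1) * n.factorial * hB
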